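/- Let K be an n×n real symmetric positive semidefinite matrix, let k < n, let δ̄ = (1/(n−k))(tr(K) − Σ_{j=1}^k σ_j(K)), and set K̄ = K − δ̄ I_n. Let λ_1(K) ≥ … ≥ λ_n(K) be the eigenvalues of K and let λ_1(K̄²) ≥ … ≥ λ_n(K̄²) be the eigenvalues of K̄² in descending order. Then Σ_{i=k+1}^n λ_i(K̄²) ≤ ‖K − K_k‖_F² − (Σ_{i=k+1}^n λ_i(K))² / (n − k). -/

import Mathlib

open Matrix BigOperators
open scoped Classical

noncomputable section

/-- `B` satisfies the four Penrose conditions for `A`. -/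
def IsMoorePenrose {m n : Type*} [Fintype m] [Fintype n]
    (A : Matrix m n ℝ) (B : Matrix n m ℝ) : Prop :=
  A * B * A = A ∧ B * A * B = B ∧ (A * B)ᵀ = A * B ∧ (B * A)ᵀ = B * A

/-- The Moore–Penrose pseudoinverse of a real matrix (defined via the unique
matrix satisfying the four Penrose conditions, which always exists). -/
def pinv {m n : Type*} [Fintype m] [Fintype n] (A : Matrix m n ℝ) : Matrix n m ℝ :=
  if h : ∃ B, IsMoorePenrose A B then h.choose else 0

/-- Squared Frobenius norm. -/
def frobSq {m n : Type*} [Fintype m] [Fintype n] (A : Matrix m n ℝ) : ℝ :=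
  ∑ i, ∑ j, (A i j) ^ 2

/-- Frobenius norm. -/
def frobNorm {m n : Type*} [Fintype m] [Fintype n] (A : Matrix m n ℝ) : ℝ :=
  Real.sqrt (frobSq A)

/-- Eigenvalues of a (hermitian) real matrix, sorted in descending order
(junk value `0` if the matrix is not hermitian). -/
def eigsDesc {n : ℕ} (A : Matrix (Fin n) (Fin n) ℝ) : Fin n → ℝ :=
  if hA : A.IsHermitian then
    fun i => hA.eigenvalues (Tuple.sort (fun j => -hA.eigenvalues j) i)
  else 0

/-- Singular values of a real matrix, sorted in descending order. -/
def svalsDesc {m n : ℕ} (A : Matrix (Fin m) (Fin n) ℝ) : Fin n → ℝ :=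
  fun i => Real.sqrt (eigsDesc (Aᵀ * A) i)

/-- Spectral norm (largest singular value). -/
def specNorm {m n : ℕ} (A : Matrix (Fin m) (Fin n) ℝ) : ℝ := ⨆ i, svalsDesc A i

/-- `Ak` is a best rank-`k` approximation of `A` in Frobenius norm. -/
def IsBestRankApprox {m n : Type*} [Fintype m] [Fintype n]
    (A Ak : Matrix m n ℝ) (k : ℕ) : Prop :=
  Ak.rank ≤ k ∧ ∀ X : Matrix m n ℝ, X.rank ≤ k → frobSq (A - Ak) ≤ frobSq (A - X)

/-- `P` is a column selection matrix: each column is a distinct standard basis vector. -/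
def IsColSelection {n c : ℕ} (P : Matrix (Fin n) (Fin c) ℝ) : Prop :=
  ∃ f : Fin c → Fin n, Function.Injective f ∧
    P = Matrix.of fun i j => if i = f j then 1 else 0

/-- Adaptive sampling probabilities for a residual matrix `B`
(uniform in the degenerate case `B = 0`). -/
def adaptP {m n : Type*} [Fintype m] [Fintype n] (B : Matrix m n ℝ) : n → ℝ :=
  fun j => if frobSq B = 0 then (Fintype.card n : ℝ)⁻¹ else (∑ i, (B i j) ^ 2) / frobSq B

/-- Uniform sampling matrix with entries `√(n/s)` at positions `(t j, j)`. -/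
def uSamp (n : ℕ) {s : ℕ} (t : Fin s → Fin n) : Matrix (Fin n) (Fin s) ℝ :=
  Matrix.of fun i j => if i = t j then Real.sqrt ((n : ℝ) / s) else 0

/-- Weighted sampling matrix with entries `1/√(s p i)` at positions `(t j, j)`. -/
def wSamp {n s : ℕ} (p : Fin n → ℝ) (t : Fin s → Fin n) : Matrix (Fin n) (Fin s) ℝ :=
  Matrix.of fun i j => if i = t j then 1 / Real.sqrt (s * p i) else 0

end

/-- Weighted tail inequality. -/
theorem weight_tail {n k : ℕ} (hkn : k < n) (μ t : Fin n → ℝ) (hμ : Antitone μ)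
    (h0 : ∀ i, 0 ≤ t i) (h1 : ∀ i, t i ≤ 1)
    (hc : 0 ≤ μ ⟨k, hkn⟩ * (∑ i, t i - ((n : ℝ) - k))) :
    ∑ i ∈ Finset.univ.filter (fun i : Fin n => k ≤ (i : ℕ)), μ i ≤ ∑ i, μ i * t i := by
  have hcard : ∑ i : Fin n, (if k ≤ (i : ℕ) then (1 : ℝ) else 0) = (n : ℝ) - k := by
    rw [Finset.sum_boole]
    have : (Finset.univ.filter (fun i : Fin n => k ≤ (i : ℕ))) = Finset.Ici ⟨k, hkn⟩ := by
      ext i; simp [Fin.le_def]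
    rw [this, Fin.card_Ici]
    simp [Nat.cast_sub hkn.le]
  rw [Finset.sum_filter]
  have key : ∀ i : Fin n, μ ⟨k, hkn⟩ * (t i - if k ≤ (i : ℕ) then (1 : ℝ) else 0) ≤
      μ i * t i - if k ≤ (i : ℕ) then μ i else 0 := by
    intro i
    split_ifs with h
    · have := hμ (show (⟨k, hkn⟩ : Fin n) ≤ i from h)
      nlinarith [h1 i]
    · have := hμ (show i ≤ (⟨k, hkn⟩ : Fin n) from (not_le.mp h).le)
      nlinarith [h0 i]
  have hs := Finset.sum_le_sum (fun i (_ : i ∈ Finset.univ) => key i)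
  rw [← Finset.mul_sum, Finset.sum_sub_distrib, Finset.sum_sub_distrib, hcard] at hs
  linarith

theorem card_tail {n k : ℕ} (hkn : k < n) :
    ((Finset.univ.filter (fun i : Fin n => k ≤ (i : ℕ))).card : ℝ) = (n : ℝ) - k := by
  have : (Finset.univ.filter (fun i : Fin n => k ≤ (i : ℕ))) = Finset.Ici ⟨k, hkn⟩ := by
    ext i; simp [Fin.le_def]
  rw [this, Fin.card_Ici]
  simp [Nat.cast_sub hkn.le]

theorem quad_form {n : ℕ} (T : EuclideanSpace ℝ (Fin n) →ₗ[ℝ] EuclideanSpace ℝ (Fin n))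
    (u : OrthonormalBasis (Fin n) ℝ (EuclideanSpace ℝ (Fin n))) (μ : Fin n → ℝ)
    (hu : ∀ i, T (u i) = μ i • u i) (v : EuclideanSpace ℝ (Fin n)) :
    inner ℝ v (T v) = ∑ j, μ j * (inner ℝ (u j) v) ^ 2 := by
  conv_lhs => rw [← u.sum_repr' v, map_sum]
  simp only [map_smul, hu]
  rw [u.sum_repr' v, inner_sum]
  refine Finset.sum_congr rfl fun j _ => ?_
  rw [inner_smul_right, inner_smul_right, real_inner_comm]
  ring

/-- Ky Fan for tails. -/
theorem tail_le {n k : ℕ} (hkn : k < n)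
    (T : EuclideanSpace ℝ (Fin n) →ₗ[ℝ] EuclideanSpace ℝ (Fin n))
    (u v : OrthonormalBasis (Fin n) ℝ (EuclideanSpace ℝ (Fin n))) (μ g : Fin n → ℝ)
    (hμ : Antitone μ)
    (hu : ∀ i, T (u i) = μ i • u i) (hv : ∀ i, T (v i) = g i • v i) :
    ∑ i ∈ Finset.univ.filter (fun i : Fin n => k ≤ (i : ℕ)), μ i ≤
      ∑ i ∈ Finset.univ.filter (fun i : Fin n => k ≤ (i : ℕ)), g i := by
  have hg : ∀ i, g i = ∑ j, μ j * (inner ℝ (u j) (v i)) ^ 2 := by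
    intro i
    rw [← quad_form T u μ hu, hv, inner_smul_right]
    simp
  have : ∑ i ∈ Finset.univ.filter (fun i : Fin n => k ≤ (i : ℕ)), g i =
      ∑ j, μ j * ∑ i ∈ Finset.univ.filter (fun i : Fin n => k ≤ (i : ℕ)),
        (inner ℝ (u j) (v i)) ^ 2 := by
    simp only [hg, Finset.mul_sum]
    rw [Finset.sum_comm]
  rw [this]
  apply weight_tail hkn μ _ hμ
  · intro j; positivity
  · intro j
    calc _ ≤ ∑ i, (inner ℝ (u j) (v i)) ^ 2 :=
          Finset.sum_le_sum_of_subset_of_nonneg (Finset.subset_univ _) (fun _ _ _ => sq_nonneg _)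
      _ = 1 := by rw [v.sum_sq_inner_left]; simp
  · rw [Finset.sum_comm]
    simp only [u.sum_sq_inner_right]
    simp [card_tail hkn]

theorem tail_succ {n : ℕ} (f : Fin n → ℝ) (i : Fin n) :
    ∑ j ∈ Finset.univ.filter (fun j : Fin n => (i : ℕ) ≤ (j : ℕ)), f j =
      f i + ∑ j ∈ Finset.univ.filter (fun j : Fin n => (i : ℕ) + 1 ≤ (j : ℕ)), f j := by
  rw [← Finset.sum_insert (s := Finset.univ.filter (fun j : Fin n => (i : ℕ) + 1 ≤ (j : ℕ)))
    (a := i) (by simp)]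
  refine Finset.sum_congr ?_ fun _ _ => rfl
  ext j
  simp only [Finset.mem_filter, Finset.mem_univ, true_and, Finset.mem_insert, Fin.ext_iff]
  omega

theorem eigs_unique {n : ℕ}
    (T : EuclideanSpace ℝ (Fin n) →ₗ[ℝ] EuclideanSpace ℝ (Fin n))
    (u v : OrthonormalBasis (Fin n) ℝ (EuclideanSpace ℝ (Fin n))) (μ g : Fin n → ℝ)
    (hμ : Antitone μ) (hg : Antitone g)
    (hu : ∀ i, T (u i) = μ i • u i) (hv : ∀ i, T (v i) = g i • v i) : μ = g := by
  have htail : ∀ k : ℕ, ∑ i ∈ Finset.univ.filter (fun i : Fin n => k ≤ (i : ℕ)), μ i =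
      ∑ i ∈ Finset.univ.filter (fun i : Fin n => k ≤ (i : ℕ)), g i := by
    intro k
    by_cases hk : k < n
    · exact le_antisymm (tail_le hk T u v μ g hμ hu hv) (tail_le hk T v u g μ hg hv hu)
    · have : (Finset.univ.filter (fun i : Fin n => k ≤ (i : ℕ))) = ∅ := by
        ext i; have := i.2; simp; omega
      rw [this]; simp
  funext i
  have h1 := htail i
  rw [tail_succ, tail_succ, htail] at h1
  linarith

theorem eigsDesc_spec {n : ℕ} (A : Matrix (Fin n) (Fin n) ℝ) (hA : A.IsHermitian) :
    Antitone (eigsDesc A) ∧ ∑ i, eigsDesc A i = A.trace ∧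
      ∃ u : OrthonormalBasis (Fin n) ℝ (EuclideanSpace ℝ (Fin n)),
        ∀ i, Matrix.toEuclideanLin A (u i) = eigsDesc A i • u i := by
  have he : eigsDesc A = fun i => hA.eigenvalues (Tuple.sort (fun j => -hA.eigenvalues j) i) := by
    unfold eigsDesc; rw [dif_pos hA]
  refine ⟨?_, ?_, hA.eigenvectorBasis.reindex (Tuple.sort (fun j => -hA.eigenvalues j)).symm, ?_⟩
  · intro i j hij
    have := Tuple.monotone_sort (fun j => -hA.eigenvalues j) hij
    simp only [Function.comp] at this
    simp only [he]
    linarith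
  · rw [he, hA.trace_eq_sum_eigenvalues]
    simp only [Equiv.sum_comp (Tuple.sort (fun j => -hA.eigenvalues j)) hA.eigenvalues]
    simp
  · intro i
    simp only [he, OrthonormalBasis.reindex_apply, Equiv.symm_symm]
    rw [Matrix.toLpLin_apply, hA.mulVec_eigenvectorBasis]
    rfl

theorem frobSq_eq_basis {n : ℕ} (M : Matrix (Fin n) (Fin n) ℝ)
    (u : OrthonormalBasis (Fin n) ℝ (EuclideanSpace ℝ (Fin n))) :
    frobSq M = ∑ i, ‖Matrix.toEuclideanLin M (u i)‖ ^ 2 := by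
  simp only [EuclideanSpace.norm_sq_eq, Real.norm_eq_abs, sq_abs]
  rw [Finset.sum_comm]
  unfold frobSq
  refine Finset.sum_congr rfl fun a _ => ?_
  have h := u.sum_sq_inner_left (WithLp.toLp 2 (M a))
  rw [EuclideanSpace.norm_sq_eq] at h
  simp only [Real.norm_eq_abs, sq_abs] at h
  rw [← h]
  refine Finset.sum_congr rfl fun i _ => ?_
  rw [Matrix.toLpLin_apply]
  simp [Matrix.mulVec, dotProduct, PiLp.inner_apply, mul_comm]

/-- Eckart–Young lower bound. -/
theorem eckart_young {n k : ℕ} (hkn : k < n) (K X : Matrix (Fin n) (Fin n) ℝ)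
    (hX : X.rank ≤ k)
    (u : OrthonormalBasis (Fin n) ℝ (EuclideanSpace ℝ (Fin n))) (l : Fin n → ℝ)
    (hu : ∀ i, Matrix.toEuclideanLin K (u i) = l i • u i)
    (hl : Antitone (fun i => l i ^ 2)) :
    ∑ i ∈ Finset.univ.filter (fun i : Fin n => k ≤ (i : ℕ)), l i ^ 2 ≤ frobSq (K - X) := by
  set R := LinearMap.range (Matrix.toEuclideanLin X) with hR
  have hfin : Module.finrank ℝ R = X.rank := by
    rw [Matrix.rank_eq_finrank_range_toLin X (EuclideanSpace.basisFun (Fin n) ℝ).toBasis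
      (EuclideanSpace.basisFun (Fin n) ℝ).toBasis, ← Matrix.toEuclideanLin_eq_toLin_orthonormal]
  have hsplit : ∀ x, ‖x‖ ^ 2 = ‖R.starProjection x‖ ^ 2 + ‖Rᗮ.starProjection x‖ ^ 2 :=
    fun x => R.norm_sq_eq_add_norm_sq_starProjection x
  have hsum : ∑ i, ‖R.starProjection (u i)‖ ^ 2 = X.rank := by
    rw [← hfin]
    have : ∀ i, ‖R.starProjection (u i)‖ ^ 2 =
        ∑ a, (inner ℝ ((stdOrthonormalBasis ℝ R a : R) : EuclideanSpace ℝ (Fin n)) (u i)) ^ 2 := by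
      intro i
      have := (stdOrthonormalBasis ℝ R).sum_sq_inner_right (R.orthogonalProjectionOnto (u i))
      rw [Submodule.starProjection_apply, Submodule.norm_coe, ← this]
      refine Finset.sum_congr rfl fun a _ => ?_
      rw [Submodule.inner_orthogonalProjectionOnto_eq_of_mem_left]
    simp only [this]
    rw [Finset.sum_comm]
    have h1 : ∀ a, ∑ i, (inner ℝ ((stdOrthonormalBasis ℝ R a : R) : EuclideanSpace ℝ (Fin n))
        (u i)) ^ 2 = 1 := by
      intro a
      rw [u.sum_sq_inner_left, Submodule.norm_coe, OrthonormalBasis.norm_eq_one, one_pow]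
    rw [Finset.sum_congr rfl fun a _ => h1 a]
    simp
  rw [frobSq_eq_basis _ u]
  refine (weight_tail hkn (fun i => l i ^ 2) (fun i => ‖Rᗮ.starProjection (u i)‖ ^ 2) hl
    (fun i => sq_nonneg _) ?_ ?_).trans ?_
  · intro i
    have := hsplit (u i)
    simp only [u.norm_eq_one] at this
    nlinarith [sq_nonneg ‖R.starProjection (u i)‖]
  · apply mul_nonneg (sq_nonneg _)
    have h2 : ∑ i, ‖u i‖ ^ 2 = ∑ i, ‖R.starProjection (u i)‖ ^ 2 +
        ∑ i, ‖Rᗮ.starProjection (u i)‖ ^ 2 := by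
      rw [← Finset.sum_add_distrib]
      exact Finset.sum_congr rfl fun i _ => hsplit _
    rw [hsum] at h2
    simp only [u.norm_eq_one, one_pow, Finset.sum_const, Finset.card_univ, Fintype.card_fin,
      nsmul_eq_mul, mul_one] at h2
    have : (X.rank : ℝ) ≤ k := by exact_mod_cast hX
    linarith
  · refine Finset.sum_le_sum fun i _ => ?_
    have h3 := hsplit (Matrix.toEuclideanLin (K - X) (u i))
    have h4 : Rᗮ.starProjection (Matrix.toEuclideanLin (K - X) (u i)) =
        l i • Rᗮ.starProjection (u i) := by
      rw [map_sub, LinearMap.sub_apply, hu, map_sub, map_smul]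
      have : Rᗮ.starProjection (Matrix.toEuclideanLin X (u i)) = 0 := by
        rw [Submodule.starProjection_apply_eq_zero_iff]
        exact Submodule.le_orthogonal_orthogonal R (LinearMap.mem_range_self _ _)
      rw [this, sub_zero]
    rw [h3, h4, norm_smul, mul_pow, Real.norm_eq_abs, sq_abs]
    nlinarith [sq_nonneg ‖R.starProjection (Matrix.toEuclideanLin (K - X) (u i))‖]

/-- Tail eigenvalue bound after spectral shifting by `δ̄`. -/
theorem shifted_tail_eigenvalue_bound {n k : ℕ} (hkn : k < n)
    (K : Matrix (Fin n) (Fin n) ℝ) (hK : K.PosSemidef)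
    (δbar : ℝ)
    (hδbar : δbar = (K.trace - ∑ j : Fin k, svalsDesc K (Fin.castLE hkn.le j)) / ((n : ℝ) - k))
    (Kbar : Matrix (Fin n) (Fin n) ℝ) (hKbar : Kbar = K - δbar • (1 : Matrix (Fin n) (Fin n) ℝ))
    (Kk : Matrix (Fin n) (Fin n) ℝ) (hKk : IsBestRankApprox K Kk k) :
    ∑ i ∈ Finset.univ.filter (fun i : Fin n => k ≤ (i : ℕ)), eigsDesc (Kbar * Kbar) i ≤
      frobSq (K - Kk) -
        (∑ i ∈ Finset.univ.filter (fun i : Fin n => k ≤ (i : ℕ)), eigsDesc K i) ^ 2 /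
          ((n : ℝ) - k) := by
  have hH := hK.isHermitian
  obtain ⟨hanti, htr, u, hu⟩ := eigsDesc_spec K hH
  set l := eigsDesc K with hl
  have hm : (0 : ℝ) < (n : ℝ) - k := by
    have : (k : ℝ) < n := by exact_mod_cast hkn
    linarith
  have hpos : ∀ i, 0 ≤ l i := by
    intro i
    rw [hl]
    simp only [eigsDesc, hH, dif_pos]
    exact hK.eigenvalues_nonneg _
  have hanti2 : Antitone (fun i => l i ^ 2) := fun i j hij =>
    pow_le_pow_left₀ (hpos j) (hanti hij) 2
  have hmul : ∀ (A B : Matrix (Fin n) (Fin n) ℝ) x,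
      Matrix.toEuclideanLin (A * B) x = Matrix.toEuclideanLin A (Matrix.toEuclideanLin B x) := by
    intro A B x
    simp [Matrix.toLpLin_apply, Matrix.mulVec_mulVec]
  -- singular values
  have hKt : Kᵀ = K := by simpa using hH.eq
  have hsv : svalsDesc K = l := by
    have hKK : (K * K).IsHermitian := by
      rw [Matrix.IsHermitian, Matrix.conjTranspose_mul, hH.eq]
    obtain ⟨ha, -, v, hv⟩ := eigsDesc_spec (K * K) hKK
    have := eigs_unique (Matrix.toEuclideanLin (K * K)) v u _ (fun i => l i ^ 2) ha hanti2 hv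
      (fun i => by rw [hmul, hu, map_smul, hu, smul_smul, sq])
    funext i
    simp only [svalsDesc, hKt, this]
    exact Real.sqrt_sq (hpos i)
  have hS : K.trace - ∑ j : Fin k, svalsDesc K (Fin.castLE hkn.le j) =
      ∑ i ∈ Finset.univ.filter (fun i : Fin n => k ≤ (i : ℕ)), l i := by
    rw [hsv, ← htr, ← Finset.sum_filter_add_sum_filter_not Finset.univ
      (fun i : Fin n => k ≤ (i : ℕ)) l]
    have : ∑ j : Fin k, l (Fin.castLE hkn.le j) =
        ∑ i ∈ Finset.univ.filter (fun i : Fin n => ¬ k ≤ (i : ℕ)), l i := by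
      refine Finset.sum_bij (fun j _ => Fin.castLE hkn.le j) ?_ ?_ ?_ ?_
      · intro j _; simp
      · intro a _ b _ h; simpa using h
      · intro b hb
        simp at hb
        exact ⟨⟨b, hb⟩, by simp, by ext; simp⟩
      · intro j _; rfl
    rw [this]; ring
  rw [hS] at hδbar
  -- shifted matrix
  have hBu : ∀ i, Matrix.toEuclideanLin Kbar (u i) = (l i - δbar) • u i := by
    intro i
    rw [hKbar, map_sub, LinearMap.sub_apply, hu, map_smul, LinearMap.smul_apply, sub_smul]
    simp [Matrix.toLpLin_apply]
  have hBH : Kbar.IsHermitian := by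
    rw [hKbar]
    refine hH.sub ?_
    simp [Matrix.IsHermitian, Matrix.conjTranspose_smul]
  have hBB : (Kbar * Kbar).IsHermitian := by
    rw [Matrix.IsHermitian, Matrix.conjTranspose_mul, hBH.eq]
  obtain ⟨ha, -, v, hv⟩ := eigsDesc_spec (Kbar * Kbar) hBB
  have h1 := tail_le hkn (Matrix.toEuclideanLin (Kbar * Kbar)) v u _
    (fun i => (l i - δbar) ^ 2) ha hv
    (fun i => by rw [hmul, hBu, map_smul, hBu, smul_smul, sq])
  have h2 := eckart_young hkn K Kk hKk.1 u l hu hanti2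
  have h3 : ∑ i ∈ Finset.univ.filter (fun i : Fin n => k ≤ (i : ℕ)), (l i - δbar) ^ 2 =
      ∑ i ∈ Finset.univ.filter (fun i : Fin n => k ≤ (i : ℕ)), l i ^ 2 -
      (∑ i ∈ Finset.univ.filter (fun i : Fin n => k ≤ (i : ℕ)), l i) ^ 2 / ((n : ℝ) - k) := by
    have : ∀ i, (l i - δbar) ^ 2 = l i ^ 2 - 2 * δbar * l i + δbar ^ 2 := fun i => by ring
    simp only [this]
    rw [Finset.sum_add_distrib, Finset.sum_sub_distrib, ← Finset.mul_sum, Finset.sum_const,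
      nsmul_eq_mul, card_tail hkn, hδbar]
    field_simp
    ring
  linarith
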